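/- Let k be a field, let E be a k-vector space of finite dimension n, let V ≤ E be a subspace of dimension n − 1, and let 1 ≤ d ≤ n. Then there is a bijection between the set { W ≤ E : dim_k W = d and W is not contained in V } and the disjoint union (sigma type), over all subspaces U ≤ V with dim_k U = d − 1, of the quotient vector spaces V ⧸ U; under this bijection the first projection corresponds to the map W ↦ W ∩ V. -/

import Mathlib

open Module

/-- Let `E` be an `n`-dimensional vector space over a field `k`, `V ≤ E` a subspace of
dimension `n - 1`, and `1 ≤ d ≤ n`. Then the set of `d`-dimensional subspaces of `E`
not contained in `V` is in bijection with the disjoint union, over all subspaces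
`U ≤ V` with `dim U = d - 1`, of the quotient spaces `V ⧸ U`; under this bijection
the first projection corresponds to `W ↦ W ∩ V`. -/
theorem stmt_5 {k E : Type*} [Field k] [AddCommGroup E] [Module k E]
    [FiniteDimensional k E] {n d : ℕ}
    (hd : 1 ≤ d) (hn : d ≤ n)
    (hE : finrank k E = n)
    (V : Submodule k E) (hV : finrank k V = n - 1) :
    ∃ e : {W : Submodule k E // finrank k W = d ∧ ¬ W ≤ V} ≃
        (Σ U : {U : Submodule k E // U ≤ V ∧ finrank k U = d - 1},
          ↥V ⧸ (U.1).comap V.subtype),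
      ∀ W : {W : Submodule k E // finrank k W = d ∧ ¬ W ≤ V},
        ((e W).1 : {U : Submodule k E // U ≤ V ∧ finrank k U = d - 1}).1 = W.1 ⊓ V := by
  have hn1 : 1 ≤ n := hd.trans hn
  have htop : ∀ S : Submodule k E, V < S → S = ⊤ := by
    intro S hS
    have h1 := Submodule.finrank_lt_finrank_of_lt hS
    have h2 := Submodule.finrank_le S
    exact Submodule.eq_top_of_finrank_eq (by omega)
  obtain ⟨x, hx⟩ : ∃ x, x ∉ V := by
    by_contra! h
    have : V = ⊤ := by
      rw [eq_top_iff]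
      exact fun y _ => h y
    rw [this, finrank_top] at hV
    omega
  have hxv : ∀ v : V, x + v ∉ V := fun v h => hx (by simpa using V.sub_mem h v.2)
  have hinf : ∀ (U : Submodule k E) (w : E), U ≤ V → w ∉ V → (U ⊔ k ∙ w) ⊓ V = U := by
    intro U w hU hw
    rw [sup_inf_assoc_of_le _ hU]
    have : (k ∙ w) ⊓ V = ⊥ := by
      rw [eq_bot_iff]
      rintro y ⟨hy, hyV⟩
      obtain ⟨c, rfl⟩ := Submodule.mem_span_singleton.1 hy
      by_cases hc : c = 0
      · simp [hc]
      · exact absurd ((V.smul_mem_iff hc).1 hyV) hw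
    rw [this, sup_bot_eq]
  have hnot : ∀ (U : Submodule k E) (w : E), w ∉ V → ¬ (U ⊔ k ∙ w) ≤ V :=
    fun U w hw h => hw (h (Submodule.mem_sup_right (Submodule.mem_span_singleton_self w)))
  have hdim : ∀ W : Submodule k E, ¬ W ≤ V →
      finrank k W = finrank k (W ⊓ V : Submodule k E) + 1 := by
    intro W hW
    have h1 := Submodule.finrank_sup_add_finrank_inf_eq W V
    rw [htop (W ⊔ V) (right_lt_sup.2 hW), finrank_top] at h1
    omega
  let g : (Σ U : {U : Submodule k E // U ≤ V ∧ finrank k U = d - 1},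
          ↥V ⧸ (U.1).comap V.subtype) → {W : Submodule k E // finrank k W = d ∧ ¬ W ≤ V} :=
    fun s => ⟨s.1.1 ⊔ k ∙ (x + (s.2.out : V)), by
      have h := hnot s.1.1 _ (hxv s.2.out)
      refine ⟨?_, h⟩
      rw [hdim _ h, hinf _ _ s.1.2.1 (hxv _), s.1.2.2]
      omega⟩
  have hg : ∀ s, (g s).1 ⊓ V = s.1.1 := fun s => hinf _ _ s.1.2.1 (hxv _)
  have hmem : ∀ s, x + (s.2.out : V) ∈ (g s).1 := fun s =>
    Submodule.mem_sup_right (Submodule.mem_span_singleton_self _)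
  have hinj : Function.Injective g := by
    rintro ⟨U, q⟩ ⟨U', q'⟩ h
    have hU : U = U' := by
      apply Subtype.ext
      rw [← hg ⟨U, q⟩, ← hg ⟨U', q'⟩, h]
    subst hU
    have h1 := hmem ⟨U, q⟩
    have h2 := hmem ⟨U, q'⟩
    rw [← h] at h2
    have h3 := Submodule.sub_mem _ h1 h2
    have h4 : ((q.out - q'.out : V) : E) ∈ (g ⟨U, q⟩).1 ⊓ V := ⟨by simpa using h3, (q.out - q'.out : V).2⟩
    rw [hg] at h4
    have h5 : q = q' := by
      rw [← Quotient.out_eq q, ← Quotient.out_eq q']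
      exact (Submodule.Quotient.eq _).2 h4
    rw [h5]
  have hsurj : Function.Surjective g := by
    rintro ⟨W, hWd, hW⟩
    obtain ⟨w, hwW, hwV⟩ := SetLike.not_le_iff_exists.1 hW
    have hw : w ∈ V ⊔ k ∙ x := by
      rw [htop (V ⊔ k ∙ x) (left_lt_sup.2 (by simpa using hx))]
      trivial
    obtain ⟨v, hv, y, hy, hvy⟩ := Submodule.mem_sup.1 hw
    obtain ⟨c, rfl⟩ := Submodule.mem_span_singleton.1 hy
    have hc : c ≠ 0 := by
      rintro rfl
      apply hwV
      rw [← hvy]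
      simpa using hv
    have hxW : x + c⁻¹ • v ∈ W := by
      have := W.smul_mem c⁻¹ hwW
      rwa [← hvy, smul_add, inv_smul_smul₀ hc, add_comm] at this
    let v' : V := ⟨c⁻¹ • v, V.smul_mem _ hv⟩
    let U : {U : Submodule k E // U ≤ V ∧ finrank k U = d - 1} :=
      ⟨W ⊓ V, inf_le_right, by have := hdim W hW; omega⟩
    let q : ↥V ⧸ (U.1).comap V.subtype := Submodule.Quotient.mk v'
    refine ⟨⟨U, q⟩, Subtype.ext ?_⟩
    have hq : q.out - v' ∈ (U.1).comap V.subtype :=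
      (Submodule.Quotient.eq _).1 (Quotient.out_eq q)
    have hq' : (q.out : E) - c⁻¹ • v ∈ W := hq.1
    have hle : (g ⟨U, q⟩).1 ≤ W := by
      refine sup_le inf_le_left ?_
      rw [Submodule.span_singleton_le_iff_mem]
      have := W.add_mem hxW hq'
      convert this using 1
      abel
    exact Submodule.eq_of_le_of_finrank_eq hle ((g ⟨U, q⟩).2.1.trans hWd.symm)
  refine ⟨(Equiv.ofBijective g ⟨hinj, hsurj⟩).symm, fun W => ?_⟩
  rw [← hg]
  congr 2
  exact (Equiv.ofBijective g ⟨hinj, hsurj⟩).apply_symm_apply W
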